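/- Let $f$ be $\mu$-strongly convex differentiable, $h$ proper closed convex, $\phi = f + h$, and fix $x_k, g_k \in \mathbb{R}^n$, $\alpha_k > 0$. Let $x_{k+1} = \arg\min_x \, g_k^T(x - x_k) + \frac{1}{2\alpha_k}\|x - x_k\|^2 + h(x)$. Then for every $x \in \mathbb{R}^n$: $\phi(x_{k+1}) \le \phi(x) + \left(\frac{1}{2\alpha_k} - \frac{\mu}{2}\right)\|x - x_k\|^2 + (\nabla f(x_k) - g_k)^T(x_{k+1} - x_k) + (g_k - \nabla f(x_k))^T(x - x_k) - \left(\frac{1}{2\alpha_k} - \frac{L}{2}\right)\|x_{k+1} - x_k\|^2$, provided $\nabla f$ is $L$-Lipschitz. -/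

import Mathlib

open scoped RealInnerProductSpace

/-- Descent lemma for a function with `L`-Lipschitz gradient. -/
theorem descent_aux {n : ℕ} (f : EuclideanSpace ℝ (Fin n) → ℝ)
    (f' : EuclideanSpace ℝ (Fin n) → EuclideanSpace ℝ (Fin n))
    (L : ℝ) (hL : 0 < L) (hgrad : ∀ x, HasGradientAt f (f' x) x)
    (hlip : LipschitzWith L.toNNReal f') (x d : EuclideanSpace ℝ (Fin n)) :
    f (x + d) ≤ f x + ⟪f' x, d⟫ + L / 2 * ‖d‖ ^ 2 := by
  have hd : ∀ t : ℝ, HasDerivAt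
      (fun t : ℝ => f (x + t • d) - t * ⟪f' x, d⟫ - L / 2 * ‖d‖ ^ 2 * t ^ 2)
      (⟪f' (x + t • d), d⟫ - ⟪f' x, d⟫ - L * ‖d‖ ^ 2 * t) t := by
    intro t
    have h1 : HasDerivAt (fun t : ℝ => x + t • d) d t := by
      simpa using ((hasDerivAt_id t).smul_const d).const_add x
    have h2 : HasDerivAt (fun t : ℝ => f (x + t • d)) ⟪f' (x + t • d), d⟫ t := by
      have h0 := (hgrad (x + t • d)).hasFDerivAt.comp_hasDerivAt t h1
      rw [InnerProductSpace.toDual_apply_apply] at h0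
      exact h0
    have h3 : HasDerivAt (fun t : ℝ => t * ⟪f' x, d⟫) ⟪f' x, d⟫ t := by
      simpa using (hasDerivAt_id t).mul_const ⟪f' x, d⟫
    have h4 : HasDerivAt (fun t : ℝ => L / 2 * ‖d‖ ^ 2 * t ^ 2) (L * ‖d‖ ^ 2 * t) t := by
      refine ((hasDerivAt_pow 2 t).const_mul (L / 2 * ‖d‖ ^ 2)).congr_deriv ?_
      push_cast
      ring
    exact (h2.sub h3).sub h4
  have hanti := antitoneOn_of_deriv_nonpos (convex_Icc (0 : ℝ) 1)
    (fun t _ => (hd t).continuousAt.continuousWithinAt)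
    (fun t _ => (hd t).differentiableAt.differentiableWithinAt)
    (by
      intro t ht
      rw [interior_Icc] at ht
      rw [(hd t).deriv, ← inner_sub_left]
      have h1 := real_inner_le_norm (f' (x + t • d) - f' x) d
      have h2 := hlip.norm_sub_le (x + t • d) x
      rw [Real.coe_toNNReal L hL.le, add_sub_cancel_left, norm_smul, Real.norm_eq_abs,
        abs_of_pos ht.1] at h2
      nlinarith [mul_le_mul_of_nonneg_right h2 (norm_nonneg d)])
  have := hanti (Set.left_mem_Icc.2 zero_le_one) (Set.right_mem_Icc.2 zero_le_one) zero_le_one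
  simp at this
  linarith

/-- The intermediate three-point inequality from the proof of Lemma 1, valid
for every comparison point `x`. -/
theorem stmt_14 {n : ℕ} (f : EuclideanSpace ℝ (Fin n) → ℝ)
    (f' : EuclideanSpace ℝ (Fin n) → EuclideanSpace ℝ (Fin n))
    (h : EuclideanSpace ℝ (Fin n) → ℝ)
    (μ L αk : ℝ) (hμ : 0 < μ) (hL : 0 < L) (hαk : 0 < αk)
    (hgrad : ∀ x, HasGradientAt f (f' x) x)
    (hsc : ∀ x y, f y + ⟪f' y, x - y⟫ + μ / 2 * ‖x - y‖ ^ 2 ≤ f x)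
    (hconvh : ConvexOn ℝ Set.univ h) (hlsch : LowerSemicontinuous h)
    (hlip : LipschitzWith L.toNNReal f')
    (xk gk xkp1 : EuclideanSpace ℝ (Fin n))
    (hstep : ∀ x, ⟪gk, xkp1 - xk⟫ + 1 / (2 * αk) * ‖xkp1 - xk‖ ^ 2 + h xkp1
      ≤ ⟪gk, x - xk⟫ + 1 / (2 * αk) * ‖x - xk‖ ^ 2 + h x) :
    ∀ x, f xkp1 + h xkp1
      ≤ (f x + h x) + (1 / (2 * αk) - μ / 2) * ‖x - xk‖ ^ 2
        + ⟪f' xk - gk, xkp1 - xk⟫ + ⟪gk - f' xk, x - xk⟫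
        - (1 / (2 * αk) - L / 2) * ‖xkp1 - xk‖ ^ 2 := by
  intro x
  have h1 := descent_aux f f' L hL hgrad hlip xk (xkp1 - xk)
  rw [add_sub_cancel] at h1
  have h2 := hstep x
  have h3 := hsc x xk
  rw [inner_sub_left, inner_sub_left]
  linarith
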